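/- Let A ∈ ℝ^{n×n} be a symmetric matrix with nonnegative entries and strictly positive row sums d_i = Σ_j A_{ij}, and set S = D_G^{-1/2} A D_G^{-1/2} where D_G = Diag(d_1,…,d_n). Let 𝒜 ∈ ℝ^{n×n×n} be a tensor with nonnegative entries and strictly positive degrees δ_i = Σ_{j,k} 𝒜_{ijk}, and set D_H = Diag(δ_1,…,δ_n). Let σ : ℝ² → ℝ be positive (σ(a,b) > 0 for all a,b > 0), one-homogeneous (σ(ca,cb) = c·σ(a,b) for all c > 0), and order-preserving on positive arguments. Define 𝒮(f) = D_H^{-1/2} 𝒜σ(D_H^{-1/2} f) where (𝒜σ(g))_i = Σ_{j,k} 𝒜_{ijk} σ(g_j, g_k), define B_{ij} = Σ_k 𝒜_{kij}, and define φ(f) = (1/2)·√(Σ_{ij} B_{ij} σ(f_i/√δ_i, f_j/√δ_j)²). Let α, β, γ ≥ 0 with α + β + γ = 1 and γ > 0, and let y ∈ ℝ^n be entrywise positive. Then for any entrywise positive f⁽⁰⁾, the sequence defined by g⁽ʳ⁾ = α·𝒮(f⁽ʳ⁾) + β·S·f⁽ʳ⁾ + γ·y and f⁽ʳ⁺¹⁾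 = g⁽ʳ⁾/φ(g⁽ʳ⁾) converges to a vector f* that is entrywise positive, satisfies φ(f*) = 1, and is the unique such fixed point of the iteration. -/

import Mathlib

open Filter Topology

namespace NH

lemma exists_scale {n : ℕ} (hn : 1 ≤ n) (a b : Fin n → ℝ) (ha : ∀ i, 0 < a i) (hb : ∀ i, 0 < b i) :
    ∃ t : ℝ, 0 < t ∧ ∀ i, t * a i ≤ b i := by
  have : Nonempty (Fin n) := ⟨⟨0, hn⟩⟩
  obtain ⟨i0, h⟩ := Finite.exists_min (fun i => b i / a i)
  refine ⟨b i0 / a i0, div_pos (hb _) (ha _), fun i => ?_⟩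
  have := h i
  exact (le_div_iff₀ (ha i)).1 this

/-- Sandwich. -/
lemma sandwich {n : ℕ} (hn : 1 ≤ n) (φ : (Fin n → ℝ) → ℝ)
    (φpos : ∀ f, (∀ i, 0 < f i) → 0 < φ f)
    (φhom : ∀ c f, 0 < c → (∀ i, 0 < f i) → φ (fun i => c * f i) = c * φ f)
    (φmono : ∀ f g, (∀ i, 0 < f i) → (∀ i, f i ≤ g i) → φ f ≤ φ g)
    (f g : Fin n → ℝ) (hf : ∀ i, 0 < f i) (hg : ∀ i, 0 < g i) (hφf : φ f = 1) (hφg : φ g = 1)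
    (ε : ℝ) (h : ∀ i j, f i * g j ≤ (1 + ε) * (f j * g i)) :
    ∃ m M : ℝ, 0 < m ∧ m ≤ 1 ∧ 1 ≤ M ∧ M ≤ (1 + ε) * m ∧ (∀ i, m * g i ≤ f i) ∧
      ∀ i, f i ≤ M * g i := by
  have : Nonempty (Fin n) := ⟨⟨0, hn⟩⟩
  obtain ⟨j0, h0⟩ := Finite.exists_min (fun i => f i / g i)
  obtain ⟨i0, h1⟩ := Finite.exists_max (fun i => f i / g i)
  have hm : ∀ i, f j0 / g j0 * g i ≤ f i := fun i => (le_div_iff₀ (hg i)).1 (h0 i)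
  have hM : ∀ i, f i ≤ f i0 / g i0 * g i := fun i => (div_le_iff₀ (hg i)).1 (h1 i)
  have mpos : 0 < f j0 / g j0 := div_pos (hf _) (hg _)
  have Mpos : 0 < f i0 / g i0 := div_pos (hf _) (hg _)
  refine ⟨_, _, mpos, ?_, ?_, ?_, hm, hM⟩
  · have := φmono (fun i => f j0 / g j0 * g i) f (fun i => mul_pos mpos (hg i)) hm
    rw [φhom _ _ mpos hg, hφf, hφg] at this
    linarith
  · have := φmono f (fun i => f i0 / g i0 * g i) hf hM
    rw [φhom _ _ Mpos hg, hφf, hφg] at this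
    linarith
  · rw [← mul_div_assoc, div_le_div_iff₀ (hg _) (hg _)]
    have := h i0 j0
    linarith

lemma dist_le {n : ℕ} (hn : 1 ≤ n) (φ : (Fin n → ℝ) → ℝ)
    (φpos : ∀ f, (∀ i, 0 < f i) → 0 < φ f)
    (φhom : ∀ c f, 0 < c → (∀ i, 0 < f i) → φ (fun i => c * f i) = c * φ f)
    (φmono : ∀ f g, (∀ i, 0 < f i) → (∀ i, f i ≤ g i) → φ f ≤ φ g)
    (f g : Fin n → ℝ) (hf : ∀ i, 0 < f i) (hg : ∀ i, 0 < g i) (hφf : φ f = 1) (hφg : φ g = 1)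
    (ε : ℝ) (hε : 0 ≤ ε) (h : ∀ i j, f i * g j ≤ (1 + ε) * (f j * g i)) (i : Fin n) :
    |f i - g i| ≤ ε * g i := by
  obtain ⟨m, M, h1, h2, h3, h4, h5, h6⟩ := sandwich hn φ φpos φhom φmono f g hf hg hφf hφg ε h
  have hM : M ≤ 1 + ε := by nlinarith
  have hm : 1 - ε ≤ m := by nlinarith
  have a := mul_le_mul_of_nonneg_right hM (hg i).le
  have b := mul_le_mul_of_nonneg_right hm (hg i).le
  have := h5 i
  have := h6 i
  rw [abs_le]
  constructor <;> linarith

lemma contract {n : ℕ} (hn : 1 ≤ n) (φ : (Fin n → ℝ) → ℝ)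
    (φpos : ∀ f, (∀ i, 0 < f i) → 0 < φ f)
    (φhom : ∀ c f, 0 < c → (∀ i, 0 < f i) → φ (fun i => c * f i) = c * φ f)
    (φmono : ∀ f g, (∀ i, 0 < f i) → (∀ i, f i ≤ g i) → φ f ≤ φ g)
    (H : (Fin n → ℝ) → Fin n → ℝ) (z : Fin n → ℝ) (hz : ∀ i, 0 < z i)
    (Hnn : ∀ f, (∀ i, 0 < f i) → ∀ i, 0 ≤ H f i)
    (Hhom : ∀ c f, 0 < c → (∀ i, 0 < f i) → ∀ i, H (fun i => c * f i) i = c * H f i)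
    (Hmono : ∀ f g, (∀ i, 0 < f i) → (∀ i, f i ≤ g i) → ∀ i, H f i ≤ H g i)
    (f g : Fin n → ℝ) (hf : ∀ i, 0 < f i) (hg : ∀ i, 0 < g i) (hφf : φ f = 1) (hφg : φ g = 1)
    (ε : ℝ) (hε : 0 ≤ ε) (h : ∀ i j, f i * g j ≤ (1 + ε) * (f j * g i))
    (θ : ℝ) (hθ0 : 0 ≤ θ) (hθ1 : θ ≤ 1) (hθ : ∀ i, θ * (H g i + z i) ≤ z i) (p q : ℝ) (hp : 0 < p)
    (hq : 0 < q) (i j : Fin n) :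
    (p * (H f i + z i)) * (q * (H g j + z j)) ≤
      (1 + (1 - θ) * ε) * ((p * (H f j + z j)) * (q * (H g i + z i))) := by
  obtain ⟨m, M, h1, h2, h3, h4, h5, h6⟩ := sandwich hn φ φpos φhom φmono f g hf hg hφf hφg ε h
  have up : ∀ i, H f i + z i ≤ (M - (M - 1) * θ) * (H g i + z i) := by
    intro i
    have a := Hmono f (fun i => M * g i) hf h6 i
    rw [Hhom _ _ (by linarith) hg] at a
    have b := mul_le_mul_of_nonneg_left (hθ i) (sub_nonneg.2 h3)
    nlinarith
  have lo : ∀ i, (m + (1 - m) * θ) * (H g i + z i) ≤ H f i + z i := by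
    intro i
    have a := Hmono (fun i => m * g i) f (fun i => mul_pos h1 (hg i)) h5 i
    rw [Hhom _ _ h1 hg] at a
    have b := mul_le_mul_of_nonneg_left (hθ i) (sub_nonneg.2 h2)
    nlinarith
  have gp : ∀ i, 0 < H g i + z i := fun i => add_pos_of_nonneg_of_pos (Hnn g hg i) (hz i)
  have key : M - (M - 1) * θ ≤ (1 + (1 - θ) * ε) * (m + (1 - m) * θ) := by
    have e1 : (1 - θ) * (M - m) ≤ (1 - θ) * (ε * m) :=
      mul_le_mul_of_nonneg_left (by linarith) (by linarith)
    have e2 : 0 ≤ (1 - θ) * ε * ((1 - m) * θ) :=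
      mul_nonneg (mul_nonneg (by linarith) hε) (mul_nonneg (by linarith) hθ0)
    nlinarith
  have main : (H f i + z i) * (H g j + z j) ≤
      (1 + (1 - θ) * ε) * ((H f j + z j) * (H g i + z i)) := by
    calc (H f i + z i) * (H g j + z j)
        ≤ ((M - (M - 1) * θ) * (H g i + z i)) * (H g j + z j) :=
          mul_le_mul_of_nonneg_right (up i) (gp j).le
      _ = (M - (M - 1) * θ) * ((H g i + z i) * (H g j + z j)) := by ring
      _ ≤ ((1 + (1 - θ) * ε) * (m + (1 - m) * θ)) * ((H g i + z i) * (H g j + z j)) :=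
          mul_le_mul_of_nonneg_right key (mul_pos (gp i) (gp j)).le
      _ = (1 + (1 - θ) * ε) * (((m + (1 - m) * θ) * (H g j + z j)) * (H g i + z i)) := by ring
      _ ≤ _ := by
          apply mul_le_mul_of_nonneg_left
          · exact mul_le_mul_of_nonneg_right (lo j) (gp i).le
          · have : 0 ≤ (1 - θ) * ε := mul_nonneg (by linarith) hε
            linarith
  have := mul_le_mul_of_nonneg_left main (mul_pos hp hq).le
  nlinarith

/-- Continuity along sequences for monotone sub-homogeneous functionals. -/
lemma tendsto_of_mono {n : ℕ} (h : (Fin n → ℝ) → ℝ)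
    (hnn : ∀ f, (∀ i, 0 < f i) → 0 ≤ h f)
    (hhom : ∀ c f, 0 < c → (∀ i, 0 < f i) → h (fun i => c * f i) = c * h f)
    (hmono : ∀ f g, (∀ i, 0 < f i) → (∀ i, f i ≤ g i) → h f ≤ h g)
    (u : ℕ → Fin n → ℝ) (w : Fin n → ℝ) (hw : ∀ i, 0 < w i)
    (hu : Tendsto u atTop (𝓝 w)) : Tendsto (fun r => h (u r)) atTop (𝓝 (h w)) := by
  have key : ∀ ε : ℝ, 0 < ε → ε < 1 → ∀ᶠ r in atTop, (1 - ε) * h w ≤ h (u r) ∧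
      h (u r) ≤ (1 + ε) * h w := by
    intro ε h0 h1
    have hu' := tendsto_pi_nhds.1 hu
    have e : ∀ᶠ r in atTop, ∀ i, (1 - ε) * w i < u r i ∧ u r i < (1 + ε) * w i := by
      rw [eventually_all]
      intro i
      have := mul_pos h0 (hw i)
      exact ((hu' i).eventually (lt_mem_nhds (by nlinarith))).and
        ((hu' i).eventually (gt_mem_nhds (by nlinarith)))
    filter_upwards [e] with r hr
    have hp : ∀ i, 0 < (1 - ε) * w i := fun i => mul_pos (by linarith) (hw i)
    constructor
    · rw [← hhom _ _ (by linarith) hw]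
      exact hmono _ _ hp (fun i => (hr i).1.le)
    · rw [← hhom _ _ (by linarith) hw]
      exact hmono _ _ (fun i => (hp i).trans (hr i).1) (fun i => (hr i).2.le)
  rw [Metric.tendsto_atTop']
  intro η hη
  have hw0 := hnn w hw
  set ε := min (1/2) (η / (2 * (h w + 1))) with hεd
  have hε : 0 < ε := lt_min (by norm_num) (by positivity)
  have hε1 : ε ≤ 1 / 2 := min_le_left _ _
  have hε2 : ε * h w < η := by
    have : ε ≤ η / (2 * (h w + 1)) := min_le_right _ _
    rw [le_div_iff₀ (by positivity)] at this
    nlinarith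
  obtain ⟨N, hN⟩ := eventually_atTop.1 (key ε hε (by linarith))
  refine ⟨N, fun r hr => ?_⟩
  have := hN r hr.le
  rw [Real.dist_eq, abs_lt]
  constructor <;> nlinarith

theorem core {n : ℕ} (hn : 1 ≤ n) (φ : (Fin n → ℝ) → ℝ)
    (φpos : ∀ f, (∀ i, 0 < f i) → 0 < φ f)
    (φhom : ∀ c f, 0 < c → (∀ i, 0 < f i) → φ (fun i => c * f i) = c * φ f)
    (φmono : ∀ f g, (∀ i, 0 < f i) → (∀ i, f i ≤ g i) → φ f ≤ φ g)
    (H : (Fin n → ℝ) → Fin n → ℝ) (z : Fin n → ℝ) (hz : ∀ i, 0 < z i)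
    (Hnn : ∀ f, (∀ i, 0 < f i) → ∀ i, 0 ≤ H f i)
    (Hhom : ∀ c f, 0 < c → (∀ i, 0 < f i) → ∀ i, H (fun i => c * f i) i = c * H f i)
    (Hmono : ∀ f g, (∀ i, 0 < f i) → (∀ i, f i ≤ g i) → ∀ i, H f i ≤ H g i)
    (v : Fin n → ℝ) (hv : ∀ i, 0 < v i) (C b : ℝ) (hC : 0 ≤ C) (hb : 0 ≤ b)
    (Hup : ∀ f t, (∀ i, 0 < f i) → φ f = 1 → (∀ i, f i ≤ t * v i) →
      ∀ i, H f i ≤ (C + b * t) * v i)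
    (Hlo : ∀ f t, 0 < t → (∀ i, 0 < f i) → φ f = 1 → (∀ i, t * v i ≤ f i) →
      ∀ i, b * t * v i ≤ H f i)
    (f0 : Fin n → ℝ) (hf0 : ∀ i, 0 < f0 i)
    (fseq : ℕ → (Fin n → ℝ)) (hseq0 : fseq 0 = f0)
    (hseq : ∀ r : ℕ, fseq (r + 1) =
      (φ (fun i => H (fseq r) i + z i))⁻¹ • (fun i => H (fseq r) i + z i)) :
    ∃ fstar : Fin n → ℝ,
      (∀ i, 0 < fstar i) ∧ φ fstar = 1 ∧
      fstar = (φ (fun i => H fstar i + z i))⁻¹ • (fun i => H fstar i + z i) ∧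
      (∀ g : Fin n → ℝ, (∀ i, 0 < g i) → φ g = 1 →
        g = (φ (fun i => H g i + z i))⁻¹ • (fun i => H g i + z i) → g = fstar) ∧
      Filter.Tendsto fseq Filter.atTop (nhds fstar) := by
  have Gpos : ∀ f, (∀ i, 0 < f i) → ∀ i, 0 < H f i + z i :=
    fun f hf i => add_pos_of_nonneg_of_pos (Hnn f hf i) (hz i)
  have Fpos : ∀ f, (∀ i, 0 < f i) → 0 < (φ (fun i => H f i + z i))⁻¹ :=
    fun f hf => inv_pos.2 (φpos _ (Gpos f hf))
  have Fφ : ∀ f, (∀ i, 0 < f i) →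
      φ ((φ (fun i => H f i + z i))⁻¹ • (fun i => H f i + z i)) = 1 := by
    intro f hf
    have := φhom _ _ (Fpos f hf) (Gpos f hf)
    refine Eq.trans ?_ (this.trans (inv_mul_cancel₀ (φpos _ (Gpos f hf)).ne'))
    rfl
  have fp : ∀ r, ∀ i, 0 < fseq r i := by
    intro r
    induction r with
    | zero => rw [hseq0]; exact hf0
    | succ r ih =>
      intro i
      rw [hseq]
      exact mul_pos (Fpos _ ih) (Gpos _ ih i)
  have fφ : ∀ r, φ (fseq (r + 1)) = 1 := fun r => by rw [hseq]; exact Fφ _ (fp r)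
  have cont_exists : ∀ f g : Fin n → ℝ, (∀ i, 0 < f i) → (∀ i, 0 < g i) →
      ∃ ε : ℝ, 0 ≤ ε ∧ ∀ i j, f i * g j ≤ (1 + ε) * (f j * g i) := by
    intro f g hf hg
    obtain ⟨s, hs, h1⟩ := exists_scale hn f g hf hg
    obtain ⟨t, ht, h2⟩ := exists_scale hn g f hg hf
    refine ⟨s⁻¹ * t⁻¹, by positivity, fun i j => ?_⟩
    have a : f i ≤ s⁻¹ * g i := by
      rw [inv_mul_eq_div, le_div_iff₀ hs]; linarith [h1 i]
    have b : g j ≤ t⁻¹ * f j := by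
      rw [inv_mul_eq_div, le_div_iff₀ ht]; linarith [h2 j]
    have := mul_le_mul a b (hg j).le (mul_pos (inv_pos.2 hs) (hg i)).le
    have := mul_pos (hf j) (hg i)
    nlinarith
  -- uniqueness
  have uniq : ∀ f g : Fin n → ℝ, (∀ i, 0 < f i) → (∀ i, 0 < g i) → φ f = 1 → φ g = 1 →
      f = (φ (fun i => H f i + z i))⁻¹ • (fun i => H f i + z i) →
      g = (φ (fun i => H g i + z i))⁻¹ • (fun i => H g i + z i) → f = g := by
    intro f g hf hg hφf hφg ef eg
    obtain ⟨ε, hε, hP⟩ := cont_exists f g hf hg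
    obtain ⟨θ, hθ, hθz⟩ := exists_scale hn (fun i => H g i + z i) z (Gpos g hg) hz
    have hθ1 : θ ≤ 1 := by
      have h1 := hθz ⟨0, hn⟩
      have h2 := Hnn g hg ⟨0, hn⟩
      have h3 := hz ⟨0, hn⟩
      by_contra hc
      push Not at hc
      nlinarith
    have step : ∀ k : ℕ, ∀ i j, f i * g j ≤ (1 + (1 - θ) ^ k * ε) * (f j * g i) := by
      intro k
      induction k with
      | zero => simpa using hP
      | succ k ih =>
        intro i j
        have := contract hn φ φpos φhom φmono H z hz Hnn Hhom Hmono f g hf hg hφf hφg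
          ((1 - θ) ^ k * ε) (mul_nonneg (pow_nonneg (by linarith) _) hε) ih θ hθ.le hθ1 hθz _ _
          (Fpos f hf) (Fpos g hg) i j
        have ef' : ∀ i, (φ (fun i => H f i + z i))⁻¹ * (H f i + z i) = f i :=
          fun i => (congrFun ef i).symm
        have eg' : ∀ i, (φ (fun i => H g i + z i))⁻¹ * (H g i + z i) = g i :=
          fun i => (congrFun eg i).symm
        rw [ef', ef', eg', eg'] at this
        rw [pow_succ']
        linarith
    funext i
    have hd : ∀ k : ℕ, |f i - g i| ≤ (1 - θ) ^ k * (ε * g i) := by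
      intro k
      have := dist_le hn φ φpos φhom φmono f g hf hg hφf hφg _
        (mul_nonneg (pow_nonneg (by linarith) k) hε) (step k) i
      linarith
    have l : Tendsto (fun k : ℕ => (1 - θ) ^ k * (ε * g i)) atTop (𝓝 (0 * (ε * g i))) :=
      (tendsto_pow_atTop_nhds_zero_of_lt_one (by linarith) (by linarith)).mul_const _
    rw [zero_mul] at l
    have := ge_of_tendsto' l hd
    exact sub_eq_zero.1 (abs_eq_zero.1 (le_antisymm this (abs_nonneg _)))
  -- invariance
  obtain ⟨c, hc, hcz⟩ := exists_scale hn v z hv hz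
  obtain ⟨Z', hZ', hZz'⟩ := exists_scale hn z v hz hv
  obtain ⟨Z, hZ, hZz⟩ : ∃ Z : ℝ, 0 < Z ∧ ∀ i, z i ≤ Z * v i := by
    refine ⟨Z'⁻¹, inv_pos.2 hZ', fun i => ?_⟩
    rw [inv_mul_eq_div, le_div_iff₀ hZ']; linarith [hZz' i]
  obtain ⟨t0, ht0, h0lo⟩ := exists_scale hn v (fseq 1) hv (fp 1)
  obtain ⟨s0, hs0, h0up⟩ := exists_scale hn (fseq 1) v (fp 1) hv
  obtain ⟨R, hR, hR1, hR2⟩ : ∃ R : ℝ, 0 < R ∧ s0⁻¹ ≤ R * t0 ∧ C + Z ≤ R * c := by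
    refine ⟨max (s0⁻¹ / t0) ((C + Z) / c), lt_max_of_lt_left (by positivity), ?_, ?_⟩
    · rw [← div_le_iff₀ ht0]; exact le_max_left _ _
    · rw [← div_le_iff₀ hc]; exact le_max_right _ _
  have inv : ∀ r, ∃ t : ℝ, 0 < t ∧ (∀ i, t * v i ≤ fseq (r + 1) i) ∧
      ∀ i, fseq (r + 1) i ≤ (R * t) * v i := by
    intro r
    induction r with
    | zero =>
      refine ⟨t0, ht0, h0lo, fun i => ?_⟩
      have : fseq 1 i ≤ s0⁻¹ * v i := by
        rw [inv_mul_eq_div, le_div_iff₀ hs0]; linarith [h0up i]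
      exact this.trans (mul_le_mul_of_nonneg_right hR1 (hv i).le)
    | succ r ih =>
      obtain ⟨t, ht, hlo, hup⟩ := ih
      have p0 := Fpos _ (fp (r + 1))
      refine ⟨(φ (fun i => H (fseq (r + 1)) i + z i))⁻¹ * (b * t + c), by positivity, ?_, ?_⟩
      · intro i
        rw [hseq (r + 1)]
        have h1 := Hlo _ t ht (fp _) (fφ r) hlo i
        have h2 := hcz i
        have : (b * t + c) * v i ≤ H (fseq (r + 1)) i + z i := by linarith
        have := mul_le_mul_of_nonneg_left this p0.le
        simp only [Pi.smul_apply, smul_eq_mul]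
        linarith
      · intro i
        rw [hseq (r + 1)]
        have h1 := Hup _ _ (fp _) (fφ r) hup i
        have h2 := hZz i
        have h3 := mul_le_mul_of_nonneg_right hR2 (hv i).le
        have : H (fseq (r + 1)) i + z i ≤ R * (b * t + c) * v i := by linarith
        have := mul_le_mul_of_nonneg_left this p0.le
        simp only [Pi.smul_apply, smul_eq_mul]
        linarith
  have vφ := φpos v hv
  have lob : ∀ r i, (R * φ v)⁻¹ * v i ≤ fseq (r + 1) i := by
    intro r i
    obtain ⟨t, ht, hlo, hup⟩ := inv r
    have := φmono _ (fun i => R * t * v i) (fp (r + 1)) hup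
    rw [φhom _ _ (by positivity) hv, fφ] at this
    refine le_trans (mul_le_mul_of_nonneg_right ?_ (hv i).le) (hlo i)
    rw [inv_le_iff_one_le_mul₀' (by positivity)]
    linarith
  have upb : ∀ r i, fseq (r + 1) i ≤ (R * (φ v)⁻¹) * v i := by
    intro r i
    obtain ⟨t, ht, hlo, hup⟩ := inv r
    have := φmono (fun i => t * v i) (fseq (r + 1)) (fun i => mul_pos ht (hv i)) hlo
    rw [φhom _ _ (by positivity) hv, fφ] at this
    refine le_trans (hup i) (mul_le_mul_of_nonneg_right ?_ (hv i).le)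
    apply mul_le_mul_of_nonneg_left _ hR.le
    rw [← one_div, le_div_iff₀ vφ]
    linarith
  obtain ⟨θ, hθ, hθ1, hθz⟩ : ∃ θ : ℝ, 0 < θ ∧ θ ≤ 1 ∧
      ∀ r i, θ * (H (fseq (r + 1)) i + z i) ≤ z i := by
    obtain ⟨θ, hθ, h1⟩ := exists_scale hn (fun i => (C + b * (R * (φ v)⁻¹) + Z) * v i) z
      (fun i => mul_pos (by positivity) (hv i)) hz
    refine ⟨min θ 1, lt_min hθ one_pos, min_le_right _ _, fun r i => ?_⟩
    have h2 := Hup _ _ (fp (r + 1)) (fφ r) (upb r) i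
    calc min θ 1 * (H (fseq (r + 1)) i + z i) ≤ θ * (H (fseq (r + 1)) i + z i) :=
          mul_le_mul_of_nonneg_right (min_le_left _ _) (Gpos _ (fp _) i).le
      _ ≤ θ * ((C + b * (R * (φ v)⁻¹) + Z) * v i) := by
          apply mul_le_mul_of_nonneg_left _ hθ.le
          have := hZz i
          linarith
      _ ≤ z i := h1 i
  obtain ⟨ε, hε, hP⟩ := cont_exists (fseq 2) (fseq 1) (fp 2) (fp 1)
  have step : ∀ r : ℕ, ∀ i j, fseq (r + 2) i * fseq (r + 1) j ≤
      (1 + (1 - θ) ^ r * ε) * (fseq (r + 2) j * fseq (r + 1) i) := by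
    intro r
    induction r with
    | zero => simpa using hP
    | succ r ih =>
      intro i j
      have := contract hn φ φpos φhom φmono H z hz Hnn Hhom Hmono _ _ (fp (r + 2)) (fp (r + 1))
        (fφ (r + 1)) (fφ r)
        ((1 - θ) ^ r * ε) (mul_nonneg (pow_nonneg (by linarith) _) hε) ih θ hθ.le hθ1 (hθz r) _ _
        (Fpos _ (fp (r + 2))) (Fpos _ (fp (r + 1))) i j
      have e : ∀ r i, (φ (fun i => H (fseq r) i + z i))⁻¹ * (H (fseq r) i + z i)
          = fseq (r + 1) i := fun r i => (congrFun (hseq r) i).symm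
      rw [e, e, e, e] at this
      rw [pow_succ']
      have e3 : r + 1 + 2 = r + 2 + 1 := by ring
      have e4 : r + 1 + 1 = r + 2 := by ring
      rw [e3, e4]
      rw [e4] at this
      linarith
  obtain ⟨U, hU0, hU⟩ : ∃ U : ℝ, 0 ≤ U ∧ ∀ r i, fseq (r + 1) i ≤ U := by
    refine ⟨R * (φ v)⁻¹ * ∑ i, v i,
      mul_nonneg (by positivity) (Finset.sum_nonneg fun i _ => (hv i).le), fun r i => ?_⟩
    refine (upb r i).trans (mul_le_mul_of_nonneg_left ?_ (by positivity))
    exact Finset.single_le_sum (f := v) (fun i _ => (hv i).le) (Finset.mem_univ i)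
  have cau : CauchySeq (fun r => fseq (r + 1)) := by
    apply cauchySeq_of_le_geometric (1 - θ) (ε * U) (by linarith)
    intro r
    have h1θ : 0 ≤ (1 - θ) ^ r := pow_nonneg (by linarith) r
    rw [dist_pi_le_iff (by positivity)]
    intro i
    rw [dist_comm, Real.dist_eq]
    have := dist_le hn φ φpos φhom φmono _ _ (fp (r + 2)) (fp (r + 1))
        (fφ (r + 1)) (fφ r) _ (mul_nonneg h1θ hε) (step r) i
    have h2 := mul_le_mul_of_nonneg_left (hU r i) (mul_nonneg h1θ hε)
    calc _ ≤ _ := this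
      _ ≤ _ := h2
      _ = _ := by ring
  obtain ⟨w, hw⟩ := cauchySeq_tendsto_of_complete cau
  have wpos : ∀ i, 0 < w i := by
    intro i
    have := ge_of_tendsto' (tendsto_pi_nhds.1 hw i) (fun r => lob r i)
    exact lt_of_lt_of_le (mul_pos (by positivity) (hv i)) this
  have wφ : φ w = 1 := by
    have := tendsto_of_mono φ (fun f hf => (φpos f hf).le) φhom φmono _ w wpos hw
    simp only [fφ] at this
    exact (tendsto_const_nhds_iff.1 this).symm
  have Gt : Tendsto (fun r => (fun i => H (fseq (r + 1)) i + z i)) atTop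
      (𝓝 (fun i => H w i + z i)) := by
    rw [tendsto_pi_nhds]
    intro i
    refine Tendsto.add_const _ ?_
    exact tendsto_of_mono (fun f => H f i) (fun f hf => Hnn f hf i)
      (fun c f hc hf => Hhom c f hc hf i) (fun f g hf hfg => Hmono f g hf hfg i) _ w wpos hw
  have Gφt := tendsto_of_mono φ (fun f hf => (φpos f hf).le) φhom φmono _ _ (Gpos w wpos) Gt
  have Ft := (Gφt.inv₀ (φpos _ (Gpos w wpos)).ne').smul Gt
  have wfix : w = (φ (fun i => H w i + z i))⁻¹ • (fun i => H w i + z i) := by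
    have h2 : Tendsto (fun r => fseq (r + 1 + 1)) atTop (𝓝 w) :=
      hw.comp (tendsto_add_atTop_nat 1)
    refine tendsto_nhds_unique h2 ?_
    simp only [hseq (_ + 1)]
    exact Ft
  exact ⟨w, wpos, wφ, wfix, fun g hg h1 h2 => uniq g w hg wpos h1 wφ h2 wfix,
    (tendsto_add_atTop_iff_nat 1).1 hw⟩

end NH

/-- **Theorem (convergence of NHOLS).**
With `S = D_G^{-1/2} A D_G^{-1/2}` the normalized adjacency matrix,
`𝒮(f) = D_H^{-1/2} 𝒜σ(D_H^{-1/2} f)` the normalized nonlinear tensor map,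
`φ` the normalizing energy, `σ` positive, one-homogeneous and order-preserving on
positive arguments, `α, β, γ ≥ 0`, `α + β + γ = 1`, `γ > 0` and `y` entrywise
positive, the NHOLS iteration `g⁽ʳ⁾ = α𝒮(f⁽ʳ⁾) + βSf⁽ʳ⁾ + γy`,
`f⁽ʳ⁺¹⁾ = g⁽ʳ⁾/φ(g⁽ʳ⁾)` converges, for any entrywise positive starting point, to an
entrywise positive `f*` with `φ(f*) = 1`, the unique such fixed point. -/
theorem nhols_convergence
    (n : ℕ) (hn : 1 ≤ n)
    (A : Matrix (Fin n) (Fin n) ℝ) (hAsymm : A.IsSymm) (hA : ∀ i j, 0 ≤ A i j)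
    (d : Fin n → ℝ) (hd : ∀ i, d i = ∑ j, A i j) (hdpos : ∀ i, 0 < d i)
    (𝒜 : Fin n → Fin n → Fin n → ℝ) (h𝒜 : ∀ i j k, 0 ≤ 𝒜 i j k)
    (δ : Fin n → ℝ) (hδ : ∀ i, δ i = ∑ j, ∑ k, 𝒜 i j k) (hδpos : ∀ i, 0 < δ i)
    (σ : ℝ → ℝ → ℝ)
    (hσpos : ∀ a b : ℝ, 0 < a → 0 < b → 0 < σ a b)
    (hσhom : ∀ c a b : ℝ, 0 < c → 0 < a → 0 < b → σ (c * a) (c * b) = c * σ a b)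
    (hσmono : ∀ a a' b b' : ℝ, 0 < a → 0 < b → a ≤ a' → b ≤ b' → σ a b ≤ σ a' b')
    (S : (Fin n → ℝ) → (Fin n → ℝ))
    (hS : ∀ f i, S f i = ∑ j, A i j / (Real.sqrt (d i) * Real.sqrt (d j)) * f j)
    (𝒮 : (Fin n → ℝ) → (Fin n → ℝ))
    (h𝒮 : ∀ f i, 𝒮 f i = (Real.sqrt (δ i))⁻¹ *
      ∑ j, ∑ k, 𝒜 i j k * σ (f j / Real.sqrt (δ j)) (f k / Real.sqrt (δ k)))
    (φ : (Fin n → ℝ) → ℝ)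
    (hφ : ∀ f, φ f = (1 / 2) * Real.sqrt (∑ i, ∑ j, (∑ k, 𝒜 k i j) *
      (σ (f i / Real.sqrt (δ i)) (f j / Real.sqrt (δ j))) ^ 2))
    (α β γ : ℝ) (hα : 0 ≤ α) (hβ : 0 ≤ β) (hγ : 0 < γ) (hsum : α + β + γ = 1)
    (y : Fin n → ℝ) (hy : ∀ i, 0 < y i)
    (f0 : Fin n → ℝ) (hf0 : ∀ i, 0 < f0 i)
    (fseq : ℕ → (Fin n → ℝ)) (hseq0 : fseq 0 = f0)
    (hseq : ∀ r : ℕ, fseq (r + 1) =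
      (φ (fun i => α * 𝒮 (fseq r) i + β * S (fseq r) i + γ * y i))⁻¹ •
        (fun i => α * 𝒮 (fseq r) i + β * S (fseq r) i + γ * y i)) :
    ∃ fstar : Fin n → ℝ,
      (∀ i, 0 < fstar i) ∧ φ fstar = 1 ∧
      fstar = (φ (fun i => α * 𝒮 fstar i + β * S fstar i + γ * y i))⁻¹ •
        (fun i => α * 𝒮 fstar i + β * S fstar i + γ * y i) ∧
      (∀ g : Fin n → ℝ, (∀ i, 0 < g i) → φ g = 1 →
        g = (φ (fun i => α * 𝒮 g i + β * S g i + γ * y i))⁻¹ •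
          (fun i => α * 𝒮 g i + β * S g i + γ * y i) → g = fstar) ∧
      Filter.Tendsto fseq Filter.atTop (nhds fstar) := by
  have sδ : ∀ i, 0 < Real.sqrt (δ i) := fun i => Real.sqrt_pos.2 (hδpos i)
  have sd : ∀ i, 0 < Real.sqrt (d i) := fun i => Real.sqrt_pos.2 (hdpos i)
  have hB : ∀ i j, 0 ≤ ∑ k, 𝒜 k i j := fun i j => Finset.sum_nonneg fun k _ => h𝒜 k i j
  have wpos : ∀ f : Fin n → ℝ, (∀ i, 0 < f i) → ∀ i, 0 < f i / Real.sqrt (δ i) :=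
    fun f hf i => div_pos (hf i) (sδ i)
  have spos : ∀ f : Fin n → ℝ, (∀ i, 0 < f i) → ∀ i j,
      0 < σ (f i / Real.sqrt (δ i)) (f j / Real.sqrt (δ j)) :=
    fun f hf i j => hσpos _ _ (wpos f hf i) (wpos f hf j)
  have shom : ∀ (c : ℝ) (f : Fin n → ℝ), 0 < c → (∀ i, 0 < f i) → ∀ i j,
      σ (c * f i / Real.sqrt (δ i)) (c * f j / Real.sqrt (δ j)) =
        c * σ (f i / Real.sqrt (δ i)) (f j / Real.sqrt (δ j)) := by
    intro c f hc hf i j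
    rw [mul_div_assoc, mul_div_assoc]
    exact hσhom _ _ _ hc (wpos f hf i) (wpos f hf j)
  have smono : ∀ f g : Fin n → ℝ, (∀ i, 0 < f i) → (∀ i, f i ≤ g i) → ∀ i j,
      σ (f i / Real.sqrt (δ i)) (f j / Real.sqrt (δ j)) ≤
        σ (g i / Real.sqrt (δ i)) (g j / Real.sqrt (δ j)) := by
    intro f g hf hfg i j
    exact hσmono _ _ _ _ (wpos f hf i) (wpos f hf j)
      (div_le_div_of_nonneg_right (hfg i) (sδ i).le) (div_le_div_of_nonneg_right (hfg j) (sδ j).le)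
  have φpos : ∀ f, (∀ i, 0 < f i) → 0 < φ f := by
    intro f hf
    rw [hφ]
    refine mul_pos (by norm_num) (Real.sqrt_pos.2 ?_)
    have tn : ∀ i j, 0 ≤ (∑ k, 𝒜 k i j) *
        (σ (f i / Real.sqrt (δ i)) (f j / Real.sqrt (δ j))) ^ 2 :=
      fun i j => mul_nonneg (hB i j) (sq_nonneg _)
    have h1 := hδpos ⟨0, hn⟩
    rw [hδ] at h1
    obtain ⟨j, -, hj⟩ := Finset.exists_ne_zero_of_sum_ne_zero h1.ne'
    obtain ⟨k, -, hk'⟩ := Finset.exists_ne_zero_of_sum_ne_zero hj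
    have hk := lt_of_le_of_ne (h𝒜 _ _ _) hk'.symm
    refine Finset.sum_pos' (fun i _ => Finset.sum_nonneg fun l _ => tn i l)
      ⟨j, Finset.mem_univ _, Finset.sum_pos' (fun l _ => tn j l) ⟨k, Finset.mem_univ _, ?_⟩⟩
    refine mul_pos (Finset.sum_pos' (fun l _ => h𝒜 l j k) ⟨_, Finset.mem_univ _, hk⟩) ?_
    exact pow_pos (spos f hf j k) 2
  have φhom : ∀ c f, 0 < c → (∀ i, 0 < f i) → φ (fun i => c * f i) = c * φ f := by
    intro c f hc hf
    rw [hφ, hφ]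
    have : ∑ i, ∑ j, (∑ k, 𝒜 k i j) *
        (σ (c * f i / Real.sqrt (δ i)) (c * f j / Real.sqrt (δ j))) ^ 2 =
        c ^ 2 * ∑ i, ∑ j, (∑ k, 𝒜 k i j) *
        (σ (f i / Real.sqrt (δ i)) (f j / Real.sqrt (δ j))) ^ 2 := by
      rw [Finset.mul_sum]
      refine Finset.sum_congr rfl fun i _ => ?_
      rw [Finset.mul_sum]
      refine Finset.sum_congr rfl fun j _ => ?_
      rw [shom c f hc hf]
      ring
    rw [this, Real.sqrt_mul (sq_nonneg c), Real.sqrt_sq hc.le]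
    ring
  have φmono : ∀ f g, (∀ i, 0 < f i) → (∀ i, f i ≤ g i) → φ f ≤ φ g := by
    intro f g hf hfg
    rw [hφ, hφ]
    refine mul_le_mul_of_nonneg_left (Real.sqrt_le_sqrt ?_) (by norm_num)
    refine Finset.sum_le_sum fun i _ => Finset.sum_le_sum fun j _ => ?_
    exact mul_le_mul_of_nonneg_left
      (pow_le_pow_left₀ (spos f hf i j).le (smono f g hf hfg i j) 2) (hB i j)
  have ac : ∀ i j, 0 ≤ A i j / (Real.sqrt (d i) * Real.sqrt (d j)) :=
    fun i j => div_nonneg (hA i j) (mul_pos (sd i) (sd j)).le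
  have Smono : ∀ f g : Fin n → ℝ, (∀ i, f i ≤ g i) → ∀ i, S f i ≤ S g i := by
    intro f g hfg i
    rw [hS, hS]
    exact Finset.sum_le_sum fun j _ => mul_le_mul_of_nonneg_left (hfg j) (ac i j)
  have Shom : ∀ (c : ℝ) (f : Fin n → ℝ) i, S (fun i => c * f i) i = c * S f i := by
    intro c f i
    rw [hS, hS, Finset.mul_sum]
    exact Finset.sum_congr rfl fun j _ => by ring
  have Sv : ∀ i, S (fun i => Real.sqrt (d i)) i = Real.sqrt (d i) := by
    intro i
    rw [hS]
    have : ∀ j, A i j / (Real.sqrt (d i) * Real.sqrt (d j)) * Real.sqrt (d j)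
        = A i j / Real.sqrt (d i) := by
      intro j
      have := (sd i).ne'
      have := (sd j).ne'
      field_simp
    simp only [this]
    rw [← Finset.sum_div, ← hd, Real.div_sqrt]
  have Snn : ∀ f : Fin n → ℝ, (∀ i, 0 < f i) → ∀ i, 0 ≤ S f i := by
    intro f hf i
    rw [hS]
    exact Finset.sum_nonneg fun j _ => mul_nonneg (ac i j) (hf j).le
  have Tnn : ∀ f : Fin n → ℝ, (∀ i, 0 < f i) → ∀ i, 0 ≤ 𝒮 f i := by
    intro f hf i
    rw [h𝒮]
    exact mul_nonneg (inv_pos.2 (sδ i)).le (Finset.sum_nonneg fun j _ =>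
      Finset.sum_nonneg fun k _ => mul_nonneg (h𝒜 i j k) (spos f hf j k).le)
  have Tmono : ∀ f g : Fin n → ℝ, (∀ i, 0 < f i) → (∀ i, f i ≤ g i) → ∀ i, 𝒮 f i ≤ 𝒮 g i := by
    intro f g hf hfg i
    rw [h𝒮, h𝒮]
    refine mul_le_mul_of_nonneg_left ?_ (inv_pos.2 (sδ i)).le
    exact Finset.sum_le_sum fun j _ => Finset.sum_le_sum fun k _ =>
      mul_le_mul_of_nonneg_left (smono f g hf hfg j k) (h𝒜 i j k)
  have Thom : ∀ (c : ℝ) (f : Fin n → ℝ), 0 < c → (∀ i, 0 < f i) → ∀ i,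
      𝒮 (fun i => c * f i) i = c * 𝒮 f i := by
    intro c f hc hf i
    rw [h𝒮, h𝒮, mul_left_comm c]
    congr 1
    rw [Finset.mul_sum]
    refine Finset.sum_congr rfl fun j _ => ?_
    rw [Finset.mul_sum]
    refine Finset.sum_congr rfl fun k _ => ?_
    rw [shom c f hc hf]
    ring
  -- boundedness of the tensor map on the slice
  have Tbd : ∀ i, ∃ K : ℝ, 0 ≤ K ∧ ∀ f : Fin n → ℝ, (∀ i, 0 < f i) → φ f = 1 → 𝒮 f i ≤ K := by
    intro i
    refine ⟨(Real.sqrt (δ i))⁻¹ * ∑ j, ∑ k, 2 * Real.sqrt (𝒜 i j k), ?_, ?_⟩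
    · exact mul_nonneg (inv_pos.2 (sδ i)).le (Finset.sum_nonneg fun j _ =>
        Finset.sum_nonneg fun k _ => by positivity)
    intro f hf h1
    rw [h𝒮]
    refine mul_le_mul_of_nonneg_left ?_ (inv_pos.2 (sδ i)).le
    refine Finset.sum_le_sum fun j _ => Finset.sum_le_sum fun k _ => ?_
    rw [hφ] at h1
    set Q := ∑ i, ∑ j, (∑ k, 𝒜 k i j) *
      (σ (f i / Real.sqrt (δ i)) (f j / Real.sqrt (δ j))) ^ 2 with hQ
    have hQ4 : Q = 4 := by
      have h2 : Real.sqrt Q = 2 := by linarith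
      have hQ0 : 0 ≤ Q := Finset.sum_nonneg fun i _ => Finset.sum_nonneg fun j _ =>
        mul_nonneg (hB i j) (sq_nonneg _)
      rw [← Real.sq_sqrt hQ0, h2]; norm_num
    set s := σ (f j / Real.sqrt (δ j)) (f k / Real.sqrt (δ k)) with hs
    have tn : ∀ i j, 0 ≤ (∑ k, 𝒜 k i j) *
        (σ (f i / Real.sqrt (δ i)) (f j / Real.sqrt (δ j))) ^ 2 :=
      fun i j => mul_nonneg (hB i j) (sq_nonneg _)
    have e1 : (∑ l, 𝒜 l j k) * s ^ 2 ≤ 4 := by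
      rw [← hQ4, hQ]
      refine le_trans ?_ (Finset.single_le_sum
        (f := fun i => ∑ j, (∑ k, 𝒜 k i j) *
          (σ (f i / Real.sqrt (δ i)) (f j / Real.sqrt (δ j))) ^ 2)
        (fun i _ => Finset.sum_nonneg fun l _ => tn i l) (Finset.mem_univ j))
      exact Finset.single_le_sum
        (f := fun l => (∑ k, 𝒜 k j l) *
          (σ (f j / Real.sqrt (δ j)) (f l / Real.sqrt (δ l))) ^ 2)
        (fun l _ => tn j l) (Finset.mem_univ k)
    have e2 : 𝒜 i j k ≤ ∑ l, 𝒜 l j k :=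
      Finset.single_le_sum (f := fun l => 𝒜 l j k) (fun l _ => h𝒜 l j k) (Finset.mem_univ i)
    have e3 : 𝒜 i j k * s ^ 2 ≤ 4 := (mul_le_mul_of_nonneg_right e2 (sq_nonneg s)).trans e1
    have e4 : 0 ≤ 𝒜 i j k := h𝒜 i j k
    have e5 := Real.sq_sqrt e4
    have e6 := Real.sqrt_nonneg (𝒜 i j k)
    have e7 : Real.sqrt (𝒜 i j k) * s ≤ 2 := by
      refine abs_le_of_sq_le_sq' ?_ (by norm_num : (0:ℝ) ≤ 2) |>.2
      rw [mul_pow, e5]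
      linarith
    calc 𝒜 i j k * s = Real.sqrt (𝒜 i j k) * (Real.sqrt (𝒜 i j k) * s) := by
          rw [← mul_assoc, ← sq, e5]
      _ ≤ Real.sqrt (𝒜 i j k) * 2 := mul_le_mul_of_nonneg_left e7 e6
      _ = 2 * Real.sqrt (𝒜 i j k) := by ring
  choose K hK0 hK using Tbd
  obtain ⟨C, hC, hCK⟩ : ∃ C : ℝ, 0 ≤ C ∧ ∀ i, α * K i ≤ C * Real.sqrt (d i) := by
    refine ⟨∑ j, α * K j / Real.sqrt (d j), Finset.sum_nonneg fun j _ =>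
      div_nonneg (mul_nonneg hα (hK0 j)) (sd j).le, fun i => ?_⟩
    rw [← div_le_iff₀ (sd i)]
    exact Finset.single_le_sum (f := fun j => α * K j / Real.sqrt (d j))
      (fun j _ => div_nonneg (mul_nonneg hα (hK0 j)) (sd j).le) (Finset.mem_univ i)
  refine NH.core hn φ φpos φhom φmono (fun f i => α * 𝒮 f i + β * S f i) (fun i => γ * y i)
    (fun i => mul_pos hγ (hy i)) ?_ ?_ ?_ (fun i => Real.sqrt (d i)) sd C β hC hβ ?_ ?_
    f0 hf0 fseq hseq0 hseq
  · intro f hf i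
    exact add_nonneg (mul_nonneg hα (Tnn f hf i)) (mul_nonneg hβ (Snn f hf i))
  · intro c f hc hf i
    simp only [Thom c f hc hf, Shom]
    ring
  · intro f g hf hfg i
    exact add_le_add (mul_le_mul_of_nonneg_left (Tmono f g hf hfg i) hα)
      (mul_le_mul_of_nonneg_left (Smono f g hfg i) hβ)
  · intro f t hf h1 hft i
    have a := mul_le_mul_of_nonneg_left (hK i f hf h1) hα
    have b := Smono f (fun i => t * Real.sqrt (d i)) hft i
    rw [Shom, Sv] at b
    have b' := mul_le_mul_of_nonneg_left b hβ
    have := hCK i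
    show α * 𝒮 f i + β * S f i ≤ (C + β * t) * Real.sqrt (d i)
    linarith
  · intro f t ht hf h1 hft i
    have b := Smono (fun i => t * Real.sqrt (d i)) f hft i
    rw [Shom, Sv] at b
    have b' := mul_le_mul_of_nonneg_left b hβ
    have := mul_nonneg hα (Tnn f hf i)
    show β * t * Real.sqrt (d i) ≤ α * 𝒮 f i + β * S f i
    linarith
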